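/- arXiv:2605.08859 — 2 statements merged into one kernel-verified Lean document; each statement's English description precedes it below -/
import Mathlib

section
/- Let α > 0, let ε > 0, let ρ satisfy α + ε ≤ ρ < 1, and let β satisfy ρ ≤ β ≤ 1. Let n, n_0, d be integers with n ≥ 1, n_0 ≥ 1 and 1 ≤ d ≤ n. Define the sequence γ : ℕ → ℝ by γ(1) = β and γ(k+1) = (1 − (1−α)/(2(γ(k) − ε − α)·n))·γ(k) for k ≥ 1. If 2(β − ρ + (α+ε)·ln(ρ/β))/(1−α) ≥ n_0/n + d(1 − ρ/β)/n + 2(1 − ρ/β)/((ρ/β)·(ρd/β + 1)) + 2(β − ε − α)/(d(1−α)), then γ(n_0) ≥ ρ. -/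
/-- The recursively defined sequence: `γ 1 = β` and
`γ (k+1) = (1 - (1-α)/(2(γ k - ε - α)·n))·γ k` for `k ≥ 1`. -/
noncomputable def gam (α ε β : ℝ) (n : ℕ) : ℕ → ℝ
  | 0 => β
  | 1 => β
  | i + 2 => (1 - (1 - α) / (2 * (gam α ε β n (i + 1) - ε - α) * n)) * gam α ε β n (i + 1)

/-- One step: with potential `F x = x - c log x`, tangent-line bounds give both claims. -/
theorem gam_step_aux (c ρ x h : ℝ) (hc : 0 < c) (hρ : c ≤ ρ) (hx : ρ ≤ x) (hh : 0 < h)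
    (hF : ρ - c * Real.log ρ + h ≤ x - c * Real.log x) :
    ρ ≤ x - h * x / (x - c) ∧
      x - c * Real.log x - h ≤ (x - h * x / (x - c)) - c * Real.log (x - h * x / (x - c)) := by
  have hρ0 : 0 < ρ := by linarith
  have hx0 : 0 < x := by linarith
  have key : ∀ y : ℝ, 0 < y → c * (Real.log y - Real.log x) ≤ c * (y / x - 1) := by
    intro y hy
    have h1 := Real.log_le_sub_one_of_pos (div_pos hy hx0)
    rw [Real.log_div hy.ne' hx0.ne'] at h1
    exact mul_le_mul_of_nonneg_left h1 hc.le
  have hne : ρ ≠ x := by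
    rintro rfl
    linarith
  have hlt : ρ < x := lt_of_le_of_ne hx hne
  have hxc : 0 < x - c := by linarith
  have hk := key ρ hρ0
  have h2 : h ≤ (x - ρ) * (x - c) / x := by
    have : (x - ρ) * (x - c) / x = x - ρ + c * (ρ / x - 1) := by
      field_simp
      ring
    rw [this]
    linarith
  have h3 : h * x / (x - c) ≤ x - ρ := by
    rw [div_le_iff₀ hxc]
    rwa [le_div_iff₀ hx0] at h2
  refine ⟨by linarith, ?_⟩
  have hk2 := key (x - h * x / (x - c)) (by linarith)
  have h4 : c * ((x - h * x / (x - c)) / x - 1) = h - h * x / (x - c) := by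
    field_simp
    ring
  rw [h4] at hk2
  linarith

/-- If the stated inequality holds, then `γ(n₀) ≥ ρ`. -/
theorem gam_ge_rho (α ε ρ β : ℝ) (hα : 0 < α) (hε : 0 < ε)
    (hρ1 : α + ε ≤ ρ) (hρ2 : ρ < 1)
    (hβ1 : ρ ≤ β) (hβ2 : β ≤ 1)
    (n n0 d : ℕ) (hn : 1 ≤ n) (hn0 : 1 ≤ n0) (hd1 : 1 ≤ d) (hdn : d ≤ n)
    (hineq : (n0 : ℝ) / n + d * (1 - ρ / β) / n
        + 2 * (1 - ρ / β) / ((ρ / β) * (ρ * d / β + 1))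
        + 2 * (β - ε - α) / (d * (1 - α))
      ≤ 2 * (β - ρ + (α + ε) * Real.log (ρ / β)) / (1 - α)) :
    ρ ≤ gam α ε β n n0 := by
  have hc : 0 < α + ε := by linarith
  have hρ0 : 0 < ρ := by linarith
  have hβ0 : 0 < β := by linarith
  have hα1 : 0 < 1 - α := by linarith
  have hnR : (0 : ℝ) < n := by exact_mod_cast hn
  have hdR : (0 : ℝ) < d := by exact_mod_cast hd1
  have hr : 0 ≤ 1 - ρ / β := by
    have : ρ / β ≤ 1 := (div_le_one hβ0).2 hβ1
    linarith
  have hbc : 0 ≤ β - ε - α := by linarith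
  have e1 : 0 ≤ d * (1 - ρ / β) / n := by positivity
  have e2 : 0 ≤ 2 * (1 - ρ / β) / ((ρ / β) * (ρ * d / β + 1)) := by positivity
  have e3 : 0 ≤ 2 * (β - ε - α) / (d * (1 - α)) := by positivity
  have hmain : (n0 : ℝ) / n ≤ 2 * (β - ρ + (α + ε) * Real.log (ρ / β)) / (1 - α) := by
    linarith
  rw [Real.log_div hρ0.ne' hβ0.ne', le_div_iff₀ hα1] at hmain
  obtain ⟨h, hh⟩ : ∃ h : ℝ, h = (1 - α) / (2 * n) := ⟨_, rfl⟩
  have hhpos : 0 < h := by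
    rw [hh]
    positivity
  have hm : ρ - (α + ε) * Real.log ρ + n0 * h ≤ β - (α + ε) * Real.log β := by
    have : (n0 : ℝ) / n * (1 - α) = 2 * (n0 * h) := by
      rw [hh]
      field_simp
    rw [this] at hmain
    linarith
  have ind : ∀ k : ℕ, k + 1 ≤ n0 → ρ ≤ gam α ε β n (k + 1) ∧
      β - (α + ε) * Real.log β - k * h ≤
        gam α ε β n (k + 1) - (α + ε) * Real.log (gam α ε β n (k + 1)) := by
    intro k
    induction k with
    | zero =>
      intro _
      simp [gam, hβ1]
    | succ k ih =>
      intro hk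
      obtain ⟨i1, i2⟩ := ih (by omega)
      have hkR : (k : ℝ) + 1 ≤ n0 := by
        have : ((k + 1 : ℕ) : ℝ) ≤ n0 := by exact_mod_cast (by omega : k + 1 ≤ n0)
        push_cast at this
        exact this
      have hkh : ((k : ℝ) + 1) * h ≤ n0 * h := mul_le_mul_of_nonneg_right hkR hhpos.le
      have hs := gam_step_aux (α + ε) ρ (gam α ε β n (k + 1)) h hc hρ1 i1 hhpos (by linarith)
      have hg : gam α ε β n (k + 1 + 1) = gam α ε β n (k + 1)
          - h * gam α ε β n (k + 1) / (gam α ε β n (k + 1) - (α + ε)) := by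
        rw [gam, hh, show gam α ε β n (k + 1) - ε - α = gam α ε β n (k + 1) - (α + ε) by ring]
        rw [mul_right_comm, ← div_div]
        ring
      rw [hg]
      refine ⟨hs.1, ?_⟩
      push_cast
      linarith [hs.2]
  obtain ⟨m, rfl⟩ : ∃ m, n0 = m + 1 := ⟨n0 - 1, by omega⟩
  exact (ind m le_rfl).1
end

section
/- Let α ∈ [1/4, 3/11) and let ρ be a real number with α < ρ < 1 satisfying 2(1 − ρ + α·ln ρ) = 1 − α. Let x be a constant with 0 < x < ρ − α, and let (ε_n)_{n≥1} and (δ_n)_{n≥1} be sequences of nonnegative real numbers converging to 0. For each integer n ≥ 1 define the sequence γ_n : ℕ → ℝ by γ_n(1) = 1 − δ_n and γ_n(k+1) = (1 − (1−α)/(2(γ_n(k) − ε_n − α)·n))·γ_n(k) for k ≥ 1. Then there exists a natural number n_x such that for all n ≥ n_x and all integers n_0 with 1 ≤ n_0 ≤ n, it holds that γ_n(n_0) − ε_n ≥ α + x. -/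
/-- Tangent-line bound for the logarithm. -/
lemma log_sub_le_aux {u v : ℝ} (hu : 0 < u) (hv : 0 < v) :
    u * (Real.log v - Real.log u) ≤ v - u := by
  have h := Real.log_le_sub_one_of_pos (div_pos hv hu)
  rw [Real.log_div hv.ne' hu.ne'] at h
  have h2 := mul_le_mul_of_nonneg_left h hu.le
  have h3 : u * (v / u - 1) = v - u := by field_simp
  linarith

/-- Monotonicity of `g - a log g` for `g ≥ a`. -/
lemma potential_mono_aux {a u v : ℝ} (ha : 0 < a) (hau : a ≤ u) (huv : u ≤ v) :
    u - a * Real.log u ≤ v - a * Real.log v := by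
  have hu : 0 < u := by linarith
  have h := log_sub_le_aux hu (show 0 < v by linarith)
  have h1 : 0 ≤ Real.log v - Real.log u := by
    have := Real.log_le_log hu huv
    linarith
  have h2 := mul_le_mul_of_nonneg_right hau h1
  linarith

/-- Deterministic version for fixed `n`. -/
lemma gam_induct_aux (α ε β x : ℝ) (n : ℕ) (hα : 0 < α) (hα1 : α < 1) (hε : 0 ≤ ε) (hx : 0 < x)
    (hβ : α + ε + x ≤ β)
    (hn : (1 - α) / 2 * (α + ε + x) ≤ x * x * n)
    (hF : (α + ε + x) - (α + ε) * Real.log (α + ε + x)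
      < β - (α + ε) * Real.log β - (1 - α) / 2) (k : ℕ) (hk : k + 1 ≤ n) :
    α + ε + x ≤ gam α ε β n (k + 1) ∧
    β - (α + ε) * Real.log β - (1 - α) / 2 * (k / n)
      ≤ gam α ε β n (k + 1) - (α + ε) * Real.log (gam α ε β n (k + 1)) := by
  have hn0 : (0 : ℝ) < n := by
    have : 0 < n := by omega
    exact_mod_cast this
  induction k with
  | zero => simpa [gam] using hβ
  | succ k ih =>
    obtain ⟨ih1, ih2⟩ := ih (by omega)
    have hg' : gam α ε β n (k + 1 + 1) =
      (1 - (1 - α) / (2 * (gam α ε β n (k + 1) - ε - α) * n)) * gam α ε β n (k + 1) := by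
      rw [gam]
    rw [hg']
    generalize gam α ε β n (k + 1) = g at ih1 ih2
    set a := α + ε with ha
    have ha0 : 0 < a := by linarith
    have hg0 : 0 < g := by linarith
    have hga : 0 < g - a := by linarith
    have hs : (1 - α) / (2 * (g - ε - α) * n) = (1 - α) / 2 / ((g - a) * n) := by
      rw [ha, div_div]
      congr 1
      ring
    rw [hs]
    set c := (1 - α) / 2 with hc
    have hc0 : 0 < c := by linarith
    set s := c / ((g - a) * n) with hsd
    have hsn : s * ((g - a) * n) = c := by
      rw [hsd]
      field_simp
    have hs0 : 0 < s := by positivity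
    have hsx : s * (a + x) ≤ x := by
      have h1 : s ≤ c / (x * n) := by
        rw [hsd]
        gcongr
        linarith
      calc s * (a + x) ≤ c / (x * n) * (a + x) := by gcongr
        _ = c * (a + x) / (x * n) := by ring
        _ ≤ x := by
          rw [div_le_iff₀ (by positivity)]
          linarith
    have hs1 : s < 1 := by
      by_contra! h
      nlinarith
    have hag : a ≤ (1 - s) * g := by nlinarith
    have hpos : 0 < (1 - s) * g := by linarith
    have key : β - a * Real.log β - c * (((k + 1 : ℕ) : ℝ) / n)
        ≤ (1 - s) * g - a * Real.log ((1 - s) * g) := by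
      have h1 := log_sub_le_aux hg0 hpos
      have h2 : Real.log ((1 - s) * g) - Real.log g ≤ - s := by
        by_contra! h
        nlinarith
      have h3 := mul_le_mul_of_nonneg_left h2 ha0.le
      have h4 : s * (g - a) = c * (1 / n) := by
        rw [← hsn]
        field_simp
      have h5 : c * (((k + 1 : ℕ) : ℝ) / n) = c * (k / n) + c * (1 / n) := by
        push_cast
        ring
      rw [h5]
      linarith
    refine ⟨?_, key⟩
    by_contra! h
    have h1 := potential_mono_aux ha0 hag h.le
    have h2 : ((k + 1 : ℕ) : ℝ) / n ≤ 1 := by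
      rw [div_le_one hn0]
      exact_mod_cast (by omega : k + 1 ≤ n)
    have h3 := mul_le_mul_of_nonneg_left h2 hc0.le
    linarith

/-- For `α ∈ [1/4, 3/11)`, `ρ` solving `2(1 - ρ + α·ln ρ) = 1 - α`, a constant
`0 < x < ρ - α` and nonnegative null sequences `ε_n, δ_n`, there is `n_x` such that
for all `n ≥ n_x` and all `1 ≤ n₀ ≤ n` one has `γ_n(n₀) - ε_n ≥ α + x`, where
`γ_n` starts at `1 - δ_n` and uses error `ε_n`. -/
theorem gam_eventually_ge_with_errors (α ρ : ℝ)
    (hα1 : 1 / 4 ≤ α) (hα2 : α < 3 / 11)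
    (hρ1 : α < ρ) (hρ2 : ρ < 1)
    (hρeq : 2 * (1 - ρ + α * Real.log ρ) = 1 - α)
    (x : ℝ) (hx0 : 0 < x) (hx : x < ρ - α)
    (ε δ : ℕ → ℝ) (hε0 : ∀ n, 0 ≤ ε n) (hδ0 : ∀ n, 0 ≤ δ n)
    (hεlim : Filter.Tendsto ε Filter.atTop (nhds 0))
    (hδlim : Filter.Tendsto δ Filter.atTop (nhds 0)) :
    ∃ nx : ℕ, ∀ n : ℕ, nx ≤ n → ∀ n0 : ℕ, 1 ≤ n0 → n0 ≤ n →
      α + x ≤ gam α (ε n) (1 - δ n) n n0 - ε n := by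
  have hα0 : 0 < α := by linarith
  have hy0 : 0 < α + x := by linarith
  have hρ0 : 0 < ρ := by linarith
  have hstrict : (α + x) - α * Real.log (α + x) < ρ - α * Real.log ρ := by
    have h := log_sub_le_aux hy0 hρ0
    have h1 : 0 < Real.log ρ - Real.log (α + x) := by
      have := Real.log_lt_log hy0 (by linarith : α + x < ρ)
      linarith
    have h2 := mul_pos hx0 h1
    linarith
  have hA : Filter.Tendsto (fun n => α + ε n) Filter.atTop (nhds α) := by
    simpa using hεlim.const_add α
  have hY : Filter.Tendsto (fun n => α + ε n + x) Filter.atTop (nhds (α + x)) :=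
    hA.add_const x
  have hB : Filter.Tendsto (fun n => 1 - δ n) Filter.atTop (nhds 1) := by
    simpa using hδlim.const_sub 1
  have hL : Filter.Tendsto (fun n => (α + ε n + x) - (α + ε n) * Real.log (α + ε n + x))
      Filter.atTop (nhds ((α + x) - α * Real.log (α + x))) :=
    hY.sub (hA.mul (hY.log hy0.ne'))
  have hR : Filter.Tendsto (fun n => (1 - δ n) - (α + ε n) * Real.log (1 - δ n) - (1 - α) / 2)
      Filter.atTop (nhds (1 - α * Real.log 1 - (1 - α) / 2)) :=
    (hB.sub (hA.mul (hB.log one_ne_zero))).sub_const _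
  have e1 := hL.eventually_lt hR (by rw [Real.log_one]; linarith)
  have e2 := hY.eventually_lt hB (by linarith)
  have hN : Filter.Tendsto (fun n : ℕ => x * x * (n : ℝ)) Filter.atTop Filter.atTop :=
    tendsto_natCast_atTop_atTop.const_mul_atTop (mul_pos hx0 hx0)
  have e3 := hN.eventually_ge_atTop ((1 - α) / 2 * (α + x + 1))
  have e4 := hY.eventually_lt_const (by linarith : α + x < α + x + 1)
  obtain ⟨nx, h⟩ := Filter.eventually_atTop.1 (e1.and (e2.and (e3.and e4)))
  refine ⟨nx, fun n hn n0 h1 h2 => ?_⟩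
  obtain ⟨f1, f2, f3, f4⟩ := h n hn
  obtain ⟨k, rfl⟩ : ∃ k, n0 = k + 1 := ⟨n0 - 1, by omega⟩
  have f5 : (1 - α) / 2 * (α + ε n + x) ≤ (1 - α) / 2 * (α + x + 1) :=
    mul_le_mul_of_nonneg_left f4.le (by linarith)
  have := (gam_induct_aux α (ε n) (1 - δ n) x n hα0 (by linarith) (hε0 n) hx0 f2.le
    (f5.trans f3) f1 k h2).1
  linarith
end
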